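/- arXiv:1912.06343 — 5 statements merged into one kernel-verified Lean document; each statement's English description precedes it below -/
import Mathlib

section
/- Let f(x,u) = A x + B u + (I − A) q, c(u) = uᵀ R u, and let (xᵉ, uᵉ) satisfy f(xᵉ, uᵉ) = xᵉ. Suppose g : ℝⁿ → ℝ is bounded below by g_min ∈ ℝ, and ρ : [0,∞) → [0,∞) is strictly increasing with ρ(0) = 0, and for all x ∈ ℝⁿ, u ∈ ℝᵐ: c(u) − c(uᵉ) + g(x) − g(f(x,u)) ≥ ρ(‖x − xᵉ‖). Then for every δ > 0, ε > 0, T ∈ ℕ, x̄ ∈ ℝⁿ, and control sequence u(0),…,u(T−1) whose trajectory x(0) = x̄, x(t+1) = f(x(t),u(t)) has total cost ∑_{t=0}^{T−1} c(u(t)) ≤ T·c(uᵉ) + δ, the number of time instants t ∈ {0,…,T−1} with ‖x(t) − xᵉ‖ > ε is at most (δ + g(x̄) − g_min)/ρ(ε). -/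
/-- Matrix-vector multiplication on Euclidean space. -/
noncomputable def mulVecE {n m : ℕ} (M : Matrix (Fin n) (Fin m) ℝ)
    (x : EuclideanSpace ℝ (Fin m)) : EuclideanSpace ℝ (Fin n) :=
  WithLp.toLp 2 fun i => ∑ j, M i j * x j

/-- Strict dissipativity (storage function `g` bounded below by `g_min`,
dissipation rate `ρ : [0,∞) → [0,∞)` strictly increasing with `ρ(0) = 0`) implies the
near-equilibrium turnpike estimate: any trajectory whose total cost is at most
`T·c(uᵉ) + δ` spends at most `(δ + g(x̄) - g_min)/ρ(ε)` time instants `t < T` at distance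
more than `ε` from `xᵉ`. -/
theorem strict_dissipativity_near_equilibrium_turnpike {n m : ℕ}
    (A : Matrix (Fin n) (Fin n) ℝ) (B : Matrix (Fin n) (Fin m) ℝ)
    (q : EuclideanSpace ℝ (Fin n)) (R : Matrix (Fin m) (Fin m) ℝ) (hR : R.PosDef)
    (f : EuclideanSpace ℝ (Fin n) → EuclideanSpace ℝ (Fin m) → EuclideanSpace ℝ (Fin n))
    (hf : ∀ x u, f x u = mulVecE A x + mulVecE B u + mulVecE (1 - A) q)
    (c : EuclideanSpace ℝ (Fin m) → ℝ)
    (hc : ∀ u, c u = ∑ i, ∑ j, u i * R i j * u j)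
    (xe : EuclideanSpace ℝ (Fin n)) (ue : EuclideanSpace ℝ (Fin m))
    (heq : f xe ue = xe)
    (g : EuclideanSpace ℝ (Fin n) → ℝ) (gmin : ℝ) (hgmin : ∀ x, gmin ≤ g x)
    (ρ : ℝ → ℝ) (hρ0 : ρ 0 = 0) (hρmono : StrictMonoOn ρ (Set.Ici 0))
    (hρnonneg : ∀ s, 0 ≤ s → 0 ≤ ρ s)
    (hdiss : ∀ (x : EuclideanSpace ℝ (Fin n)) (u : EuclideanSpace ℝ (Fin m)),
      ρ ‖x - xe‖ ≤ c u - c ue + g x - g (f x u)) :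
    ∀ (δ : ℝ), 0 < δ → ∀ (ε : ℝ), 0 < ε → ∀ (T : ℕ)
      (xbar : EuclideanSpace ℝ (Fin n)) (u : ℕ → EuclideanSpace ℝ (Fin m))
      (x : ℕ → EuclideanSpace ℝ (Fin n)),
      x 0 = xbar → (∀ t, x (t + 1) = f (x t) (u t)) →
      (∑ t ∈ Finset.range T, c (u t)) ≤ T * c ue + δ →
      (((Finset.range T).filter fun t => ε < ‖x t - xe‖).card : ℝ) ≤
        (δ + g xbar - gmin) / ρ ε := by
  intro δ _ ε hε T xbar u x hx0 hx hcost
  have hρε : 0 < ρ ε := by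
    have h := hρmono (Set.mem_Ici.2 le_rfl) (Set.mem_Ici.2 hε.le) hε
    rwa [hρ0] at h
  rw [le_div_iff₀ hρε]
  have key : ∀ N : ℕ, ∑ t ∈ Finset.range N, ρ ‖x t - xe‖ ≤
      (∑ t ∈ Finset.range N, c (u t)) - N * c ue + g (x 0) - g (x N) := by
    intro N
    induction N with
    | zero => simp
    | succ k ih =>
      rw [Finset.sum_range_succ, Finset.sum_range_succ]
      have h := hdiss (x k) (u k)
      rw [← hx k] at h
      push_cast
      linarith
  have h1 : (((Finset.range T).filter fun t => ε < ‖x t - xe‖).card : ℝ) * ρ ε ≤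
      ∑ t ∈ (Finset.range T).filter (fun t => ε < ‖x t - xe‖), ρ ‖x t - xe‖ := by
    rw [← nsmul_eq_mul]
    apply Finset.card_nsmul_le_sum
    intro t ht
    have ht' := (Finset.mem_filter.1 ht).2
    exact (hρmono (Set.mem_Ici.2 hε.le) (Set.mem_Ici.2 (norm_nonneg _)) ht').le
  have h2 : ∑ t ∈ (Finset.range T).filter (fun t => ε < ‖x t - xe‖), ρ ‖x t - xe‖ ≤
      ∑ t ∈ Finset.range T, ρ ‖x t - xe‖ :=
    Finset.sum_le_sum_of_subset_of_nonneg (Finset.filter_subset _ _)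
      (fun t _ _ => hρnonneg _ (norm_nonneg _))
  have h3 := key T
  have h4 := hgmin (x T)
  rw [hx0] at h3
  linarith
end

section
/- Let A ∈ ℝ^{n×n}, B ∈ ℝ^{n×m}, q ∈ ℝⁿ, R ∈ ℝ^{m×m} symmetric positive definite, and P ∈ ℝ^{n×n} symmetric positive definite. Suppose there exist v ∈ ℝⁿ and a strictly increasing continuous function ρ : [0,∞) → [0,∞) with ρ(0) = 0 such that, with storage function g(x) = xᵀ P x + vᵀ x, some equilibrium pair (xᵉ, uᵉ) (i.e., xᵉ = A xᵉ + B uᵉ + (I − A) q) satisfies, for all x ∈ ℝⁿ and u ∈ ℝᵐ: c(u) − c(uᵉ) + g(x) − g(A x + B u + (I − A) q) ≥ ρ(‖x − xᵉ‖), where c(u) = uᵀ R u. Then the matrix P − Aᵀ P A is positive definite. -/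
open Matrix

theorem quad_par {n : ℕ} (P : Matrix (Fin n) (Fin n) ℝ) (v x d : EuclideanSpace ℝ (Fin n))
    (g : EuclideanSpace ℝ (Fin n) → ℝ)
    (hg : ∀ x, g x = (∑ i, ∑ j, x i * P i j * x j) + ∑ i, v i * x i) :
    g (x + d) + g (x - d) = 2 * g x + 2 * ∑ i, ∑ j, d i * P i j * d j := by
  have a1 : (∑ i, ∑ j, (x + d) i * P i j * (x + d) j) + (∑ i, ∑ j, (x - d) i * P i j * (x - d) j)
      = 2 * (∑ i, ∑ j, x i * P i j * x j) + 2 * ∑ i, ∑ j, d i * P i j * d j := by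
    simp only [Finset.mul_sum, ← Finset.sum_add_distrib]
    refine Finset.sum_congr rfl fun i _ => Finset.sum_congr rfl fun j _ => ?_
    simp only [PiLp.add_apply, PiLp.sub_apply]
    ring
  have a2 : (∑ i, v i * (x + d) i) + (∑ i, v i * (x - d) i) = 2 * ∑ i, v i * x i := by
    simp only [Finset.mul_sum, ← Finset.sum_add_distrib]
    refine Finset.sum_congr rfl fun i _ => ?_
    simp only [PiLp.add_apply, PiLp.sub_apply]
    ring
  simp only [hg]
  linarith

theorem quad_dot {n : ℕ} (P : Matrix (Fin n) (Fin n) ℝ) (d : Fin n → ℝ) :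
    ∑ i, ∑ j, d i * P i j * d j = d ⬝ᵥ (P *ᵥ d) := by
  simp only [dotProduct, mulVec, Finset.mul_sum, mul_assoc]

theorem mulVecE_eq {n m : ℕ} (M : Matrix (Fin n) (Fin m) ℝ) (x : EuclideanSpace ℝ (Fin m)) :
    mulVecE M x = WithLp.toLp 2 (M *ᵥ x.ofLp) := rfl

/-- If the system `x⁺ = A x + B u + (I - A) q` with cost `c(u) = uᵀ R u`
is strictly dissipative at an equilibrium `(xᵉ, uᵉ)` with quadratic-plus-linear storage
function `g(x) = xᵀ P x + vᵀ x` (where `P` is symmetric positive definite), for some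
strictly increasing continuous `ρ : [0,∞) → [0,∞)` with `ρ(0) = 0`, then the matrix
`P - Aᵀ P A` is positive definite. -/
theorem storage_posDef_of_strict_dissipativity {n m : ℕ}
    (A : Matrix (Fin n) (Fin n) ℝ) (B : Matrix (Fin n) (Fin m) ℝ)
    (q : EuclideanSpace ℝ (Fin n)) (R : Matrix (Fin m) (Fin m) ℝ) (hR : R.PosDef)
    (P : Matrix (Fin n) (Fin n) ℝ) (hP : P.PosDef)
    (v : EuclideanSpace ℝ (Fin n))
    (ρ : ℝ → ℝ) (hρ0 : ρ 0 = 0) (hρmono : StrictMonoOn ρ (Set.Ici 0))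
    (hρcont : ContinuousOn ρ (Set.Ici 0)) (hρnonneg : ∀ s, 0 ≤ s → 0 ≤ ρ s)
    (c : EuclideanSpace ℝ (Fin m) → ℝ)
    (hc : ∀ u, c u = ∑ i, ∑ j, u i * R i j * u j)
    (g : EuclideanSpace ℝ (Fin n) → ℝ)
    (hg : ∀ x, g x = (∑ i, ∑ j, x i * P i j * x j) + ∑ i, v i * x i)
    (xe : EuclideanSpace ℝ (Fin n)) (ue : EuclideanSpace ℝ (Fin m))
    (heq : mulVecE A xe + mulVecE B ue + mulVecE (1 - A) q = xe)
    (hdiss : ∀ (x : EuclideanSpace ℝ (Fin n)) (u : EuclideanSpace ℝ (Fin m)),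
      ρ ‖x - xe‖ ≤ c u - c ue + g x - g (mulVecE A x + mulVecE B u + mulVecE (1 - A) q)) :
    (P - Aᵀ * P * A).PosDef := by
  refine Matrix.PosDef.of_dotProduct_mulVec_pos ?_ ?_
  · have hPh : Pᵀ = P := by simpa using hP.isHermitian.eq
    simp [Matrix.IsHermitian, Matrix.transpose_sub, Matrix.transpose_mul, hPh, Matrix.mul_assoc]
  · intro d hd
    set D : EuclideanSpace ℝ (Fin n) := WithLp.toLp 2 d with hD
    have hD0 : D ≠ 0 := by
      intro h
      apply hd
      simpa [hD] using h
    have hpos : 0 < ρ ‖D‖ := by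
      have := hρmono (Set.mem_Ici.2 le_rfl) (Set.mem_Ici.2 (norm_nonneg D)) (norm_pos_iff.2 hD0)
      rwa [hρ0] at this
    have h1 := hdiss (xe + D) ue
    have h2 := hdiss (xe - D) ue
    have e1 : mulVecE A (xe + D) + mulVecE B ue + mulVecE (1 - A) q = xe + mulVecE A D := by
      conv_rhs => rw [← heq]
      simp only [mulVecE_eq, WithLp.ofLp_add, Matrix.mulVec_add, WithLp.toLp_add]
      abel
    have e2 : mulVecE A (xe - D) + mulVecE B ue + mulVecE (1 - A) q = xe - mulVecE A D := by
      conv_rhs => rw [← heq]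
      simp only [mulVecE_eq, WithLp.ofLp_sub, Matrix.mulVec_sub, WithLp.toLp_sub]
      abel
    rw [e1] at h1
    rw [e2] at h2
    have n1 : ‖xe + D - xe‖ = ‖D‖ := by rw [add_sub_cancel_left]
    have n2 : ‖xe - D - xe‖ = ‖D‖ := by rw [sub_sub_cancel_left, norm_neg]
    rw [n1] at h1
    rw [n2] at h2
    have q1 := quad_par P v xe D g hg
    have q2 := quad_par P v xe (mulVecE A D) g hg
    rw [quad_dot P D.ofLp] at q1
    rw [quad_dot P (mulVecE A D).ofLp] at q2
    have e3 : star d ⬝ᵥ ((P - Aᵀ * P * A) *ᵥ d)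
        = D.ofLp ⬝ᵥ (P *ᵥ D.ofLp) - (mulVecE A D).ofLp ⬝ᵥ (P *ᵥ (mulVecE A D).ofLp) := by
      simp only [mulVecE_eq, hD, star_trivial, Matrix.sub_mulVec, dotProduct_sub]
      rw [Matrix.mul_assoc, ← Matrix.mulVec_mulVec, Matrix.dotProduct_mulVec d Aᵀ,
        Matrix.vecMul_transpose, ← Matrix.mulVec_mulVec]
    rw [e3]
    linarith
end

section
/- Let A ∈ ℝ^{n×n} be such that every (complex) eigenvalue of A has modulus strictly less than 1. Then the series P = ∑_{k=0}^{∞} (Aᵀ)ᵏ Aᵏ converges, P is symmetric positive definite, and P − Aᵀ P A = I; in particular P − Aᵀ P A is positive definite. -/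
open Matrix

section LyapAux
open scoped Matrix.Norms.Frobenius

lemma lyap_eventually {n : ℕ} (B : Matrix (Fin n) (Fin n) ℂ)
    (hspec : ∀ μ : ℂ, Module.End.HasEigenvalue (Matrix.toLin' B) μ → ‖μ‖ < 1) :
    ∃ r : ℝ, 0 ≤ r ∧ r < 1 ∧ ∀ᶠ k : ℕ in Filter.atTop, ‖B ^ k‖ ≤ r ^ k := by
  rcases Nat.eq_zero_or_pos n with h0 | hn
  · subst h0
    refine ⟨0, le_rfl, zero_lt_one, Filter.Eventually.of_forall fun k => ?_⟩
    rw [Subsingleton.elim (B ^ k) 0, norm_zero]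
    positivity
  haveI : Nonempty (Fin n) := ⟨⟨0, hn⟩⟩
  have hlt : spectralRadius ℂ B < ((1 : NNReal) : ENNReal) := by
    apply spectrum.spectralRadius_lt_of_forall_lt
    intro z hz
    rw [← Matrix.spectrum_toLin', ← Module.End.hasEigenvalue_iff_mem_spectrum] at hz
    exact hspec z hz
  obtain ⟨r, hr1, hr2⟩ := ENNReal.lt_iff_exists_nnreal_btwn.1 hlt
  refine ⟨r, r.2, by exact_mod_cast hr2, ?_⟩
  have ht := (spectrum.pow_nnnorm_pow_one_div_tendsto_nhds_spectralRadius B).eventually_lt_const hr1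
  filter_upwards [ht, Filter.eventually_gt_atTop 0] with k hk hk0
  have hk' : (0 : ℝ) < k := by exact_mod_cast hk0
  have h2 : (‖B ^ k‖₊ : ENNReal) ≤ (r : ENNReal) ^ k := by
    have h := ENNReal.rpow_le_rpow hk.le hk'.le
    rwa [← ENNReal.rpow_mul, one_div_mul_cancel hk'.ne', ENNReal.rpow_one,
      ENNReal.rpow_natCast] at h
  exact_mod_cast h2

lemma lyap_summable {n : ℕ} (A : Matrix (Fin n) (Fin n) ℝ)
    (hspec : ∀ μ : ℂ, Module.End.HasEigenvalue (Matrix.toLin' (A.map Complex.ofReal)) μ →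
      ‖μ‖ < 1) :
    Summable (fun k : ℕ => (Aᵀ) ^ k * A ^ k) := by
  obtain ⟨r, hr0, hr1, h⟩ := lyap_eventually _ hspec
  have hs : Summable (fun k : ℕ => (r * r) ^ k) :=
    summable_geometric_of_lt_one (by positivity) (by nlinarith)
  refine hs.of_norm_bounded_eventually_nat ?_
  filter_upwards [h] with k hk
  have e : (A.map Complex.ofReal) ^ k = (A ^ k).map Complex.ofReal :=
    (map_pow (Complex.ofRealHom.mapMatrix) A k).symm
  have e2 : ‖A ^ k‖ ≤ r ^ k := by
    rw [e, Matrix.frobenius_norm_map_eq _ _ (fun a => Complex.norm_real a)] at hk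
    exact hk
  refine (norm_mul_le _ _).trans ?_
  rw [← Matrix.transpose_pow, Matrix.frobenius_norm_transpose, mul_pow]
  gcongr
end LyapAux

/-- If every complex eigenvalue of the real matrix `A` has modulus
strictly less than `1`, then the series `P = ∑_{k} (Aᵀ)ᵏ Aᵏ` converges, `P` is symmetric
positive definite, `P - Aᵀ P A = I`, and in particular `P - Aᵀ P A` is positive
definite. -/
theorem lyapunov_series_of_schur_stable {n : ℕ} (A : Matrix (Fin n) (Fin n) ℝ)
    (hspec : ∀ μ : ℂ, Module.End.HasEigenvalue (Matrix.toLin' (A.map Complex.ofReal)) μ →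
      ‖μ‖ < 1) :
    Summable (fun k : ℕ => (Aᵀ) ^ k * A ^ k) ∧
    (∑' k : ℕ, (Aᵀ) ^ k * A ^ k).PosDef ∧
    (∑' k : ℕ, (Aᵀ) ^ k * A ^ k) - Aᵀ * (∑' k : ℕ, (Aᵀ) ^ k * A ^ k) * A = 1 ∧
    ((∑' k : ℕ, (Aᵀ) ^ k * A ^ k) - Aᵀ * (∑' k : ℕ, (Aᵀ) ^ k * A ^ k) * A).PosDef := by
  have hs := lyap_summable A hspec
  set P := ∑' k : ℕ, (Aᵀ) ^ k * A ^ k with hP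
  have hterm : ∀ k : ℕ, ((Aᵀ) ^ k * A ^ k).PosSemidef := fun k => by
    have := Matrix.posSemidef_conjTranspose_mul_self (A ^ k)
    rwa [Matrix.conjTranspose_eq_transpose_of_trivial, Matrix.transpose_pow] at this
  have heq : P = 1 + Aᵀ * P * A := by
    have h1 := hs.tsum_eq_zero_add
    rw [← hP] at h1
    have h2 : HasSum (fun k : ℕ => Aᵀ * ((Aᵀ) ^ k * A ^ k) * A) (Aᵀ * P * A) :=
      (hs.hasSum.mul_left Aᵀ).mul_right A
    have h3 : (fun k : ℕ => (Aᵀ) ^ (k + 1) * A ^ (k + 1)) =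
        fun k : ℕ => Aᵀ * ((Aᵀ) ^ k * A ^ k) * A := by
      funext k
      rw [pow_succ' Aᵀ, pow_succ A]
      simp only [Matrix.mul_assoc]
    rw [h3, h2.tsum_eq] at h1
    simpa using h1
  have hpsd : P.PosSemidef := by
    rw [Matrix.posSemidef_iff_dotProduct_mulVec]
    constructor
    · have : Pᴴ = P := by
        rw [hP, Matrix.conjTranspose_tsum]
        exact tsum_congr fun k => (hterm k).1
      exact this
    · intro x
      let f : Matrix (Fin n) (Fin n) ℝ →+ ℝ :=
        { toFun := fun M => star x ⬝ᵥ (M *ᵥ x)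
          map_zero' := by simp
          map_add' := by intro M N; simp [Matrix.add_mulVec] }
      have hf : Continuous f := by
        change Continuous fun M : Matrix (Fin n) (Fin n) ℝ => star x ⬝ᵥ (M *ᵥ x)
        fun_prop
      exact (hs.hasSum.map f hf).nonneg fun k => (hterm k).dotProduct_mulVec_nonneg x
  have hsub : P - Aᵀ * P * A = 1 := by
    rw [sub_eq_iff_eq_add]; exact heq
  refine ⟨hs, ?_, hsub, ?_⟩
  · rw [heq]
    refine Matrix.PosDef.one.add_posSemidef ?_
    have := hpsd.conjTranspose_mul_mul_same A
    rwa [Matrix.conjTranspose_eq_transpose_of_trivial] at this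
  · rw [hsub]; exact Matrix.PosDef.one
end

section
/- Consider the system x(t+1) = A x(t) + B u(t) + (I − A) q with stage cost c(u) = uᵀ R u, R symmetric positive definite, threshold τ ∈ ℝⁿ, and an equilibrium (xᵉ, uᵉ) with xᵉ = A xᵉ + B uᵉ + (I − A) q and xᵉ ≥ τ componentwise. Suppose the controllability matrix [B, AB, …, A^{n−1}B] has rank n, and fix T₀ ≥ n. Then for every compact set K ⊂ ℝⁿ there exists a constant D > 0 such that for all x̄ ∈ K and all horizons T ≥ T₀, the optimal cost J*_T(x̄) of the constrained problem (minimize ∑_{t=0}^{T−1} c(u(t)) subject to the trajectory from x̄ satisfying x(t) ≥ τ componentwise for t ∈ {T₀,…,T}) satisfies J*_T(x̄) ≤ T·c(uᵉ) + D; i.e., xᵉ is cheaply reachable uniformly on compact sets. -/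
open Matrix

/-- The trajectory of the affine system `x(t+1) = A x(t) + B u(t) + (I - A) q` starting
from `x(0) = x̄` under the control sequence `u`. -/
noncomputable def traj {n m : ℕ} (A : Matrix (Fin n) (Fin n) ℝ)
    (B : Matrix (Fin n) (Fin m) ℝ) (q xbar : Fin n → ℝ) (u : ℕ → Fin m → ℝ) :
    ℕ → Fin n → ℝ
  | 0 => xbar
  | t + 1 => A.mulVec (traj A B q xbar u t) + B.mulVec (u t) + (1 - A).mulVec q

/-- A control sequence is admissible for horizon `T` (with campaign start `T₀`) from `x̄`
if its trajectory satisfies the state constraint `x(t) ≥ τ` for all `t ∈ {T₀, …, T}`. -/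
def Admissible {n m : ℕ} (A : Matrix (Fin n) (Fin n) ℝ) (B : Matrix (Fin n) (Fin m) ℝ)
    (q τ : Fin n → ℝ) (T₀ T : ℕ) (xbar : Fin n → ℝ) (u : ℕ → Fin m → ℝ) : Prop :=
  ∀ t, T₀ ≤ t → t ≤ T → ∀ i, τ i ≤ traj A B q xbar u t i

/-- The Kalman controllability matrix `[B, AB, A²B, …, A^{n-1}B]`. -/
noncomputable def ctrbMatrix {n m : ℕ} (A : Matrix (Fin n) (Fin n) ℝ)
    (B : Matrix (Fin n) (Fin m) ℝ) : Matrix (Fin n) (Fin n × Fin m) ℝ :=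
  Matrix.of fun i p => (A ^ (p.1 : ℕ) * B) i p.2


theorem traj_err {n m : ℕ} (A : Matrix (Fin n) (Fin n) ℝ)
    (B : Matrix (Fin n) (Fin m) ℝ) (q xbar : Fin n → ℝ)
    (xe : Fin n → ℝ) (ue : Fin m → ℝ)
    (heq : xe = A.mulVec xe + B.mulVec ue + (1 - A).mulVec q) (v : ℕ → Fin m → ℝ) (t : ℕ) :
    traj A B q xbar (fun t => ue + v t) t = xe + ((A ^ t) *ᵥ (xbar - xe) +
      ∑ k ∈ Finset.range t, (A ^ k * B) *ᵥ (v (t - 1 - k))) := by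
  induction t with
  | zero => simp [traj]
  | succ t ih =>
    rw [traj, ih, Finset.sum_range_succ']
    have h1 : A *ᵥ (∑ k ∈ Finset.range t, (A ^ k * B) *ᵥ (v (t - 1 - k))) =
        ∑ k ∈ Finset.range t, (A ^ (k+1) * B) *ᵥ (v (t + 1 - 1 - (k + 1))) := by
      rw [Matrix.mulVec_sum]
      refine Finset.sum_congr rfl fun k _ => ?_
      rw [Matrix.mulVec_mulVec, ← Matrix.mul_assoc, ← pow_succ']
      congr 2
      omega
    rw [← h1]
    simp only [Matrix.mulVec_add, Matrix.mulVec_mulVec, ← pow_succ']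
    generalize (A ^ (t + 1)) *ᵥ (xbar - xe) = y
    conv_rhs => rw [heq]
    simp
    abel_nf

theorem traj_stay {n m : ℕ} (A : Matrix (Fin n) (Fin n) ℝ)
    (B : Matrix (Fin n) (Fin m) ℝ) (q xbar : Fin n → ℝ)
    (xe : Fin n → ℝ) (ue : Fin m → ℝ)
    (heq : xe = A.mulVec xe + B.mulVec ue + (1 - A).mulVec q) (u : ℕ → Fin m → ℝ) (N : ℕ)
    (hN : traj A B q xbar u N = xe) (hu : ∀ t, N ≤ t → u t = ue) (t : ℕ) (ht : N ≤ t) :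
    traj A B q xbar u t = xe := by
  induction t, ht using Nat.le_induction with
  | base => exact hN
  | succ t ht ih => rw [traj, ih, hu t ht, ← heq]

theorem ctrb_mulVec {n m : ℕ} (A : Matrix (Fin n) (Fin n) ℝ)
    (B : Matrix (Fin n) (Fin m) ℝ) (w : Fin n × Fin m → ℝ) :
    (ctrbMatrix A B) *ᵥ w = ∑ k : Fin n, (A ^ (k : ℕ) * B) *ᵥ (fun j => w (k, j)) := by
  ext i
  simp [ctrbMatrix, Matrix.mulVec, dotProduct, Fintype.sum_prod_type, Finset.sum_apply]

/-- Under the rank-`n` controllability condition and `T₀ ≥ n`, the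
equilibrium `xᵉ` is cheaply reachable uniformly on compact sets: for every compact
`K ⊂ ℝⁿ` there is `D > 0` such that `J*_T(x̄) ≤ T·c(uᵉ) + D` for all `x̄ ∈ K` and all
horizons `T ≥ T₀`. -/
theorem cheaply_reachable_on_compacts {n m : ℕ} (A : Matrix (Fin n) (Fin n) ℝ)
    (B : Matrix (Fin n) (Fin m) ℝ) (q τ : Fin n → ℝ)
    (R : Matrix (Fin m) (Fin m) ℝ) (hR : R.PosDef)
    (xe : Fin n → ℝ) (ue : Fin m → ℝ)
    (heq : xe = A.mulVec xe + B.mulVec ue + (1 - A).mulVec q)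
    (hxe : ∀ i, τ i ≤ xe i)
    (hrank : (ctrbMatrix A B).rank = n)
    (T₀ : ℕ) (hT₀ : n ≤ T₀) :
    ∀ K : Set (Fin n → ℝ), IsCompact K → ∃ D > (0 : ℝ),
      ∀ xbar ∈ K, ∀ T : ℕ, T₀ ≤ T →
        sInf {c : ℝ | ∃ u : ℕ → Fin m → ℝ, Admissible A B q τ T₀ T xbar u ∧
            (∑ t ∈ Finset.range T, u t ⬝ᵥ R.mulVec (u t)) = c} ≤
          (T : ℝ) * (ue ⬝ᵥ R.mulVec ue) + D := by
  intro K hK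
  have hsurj : LinearMap.range (ctrbMatrix A B).mulVecLin = ⊤ := by
    apply Submodule.eq_top_of_finrank_eq
    rw [← Matrix.rank, hrank]
    simp
  obtain ⟨g, hg⟩ := LinearMap.exists_rightInverse_of_surjective _ hsurj
  let w : (Fin n → ℝ) → (Fin n × Fin m → ℝ) := fun x => g (-((A ^ n) *ᵥ (x - xe)))
  have hw : ∀ x, (ctrbMatrix A B) *ᵥ (w x) = -((A ^ n) *ᵥ (x - xe)) := fun x =>
    LinearMap.congr_fun hg _
  have hwc : Continuous w := by
    have : Continuous g := LinearMap.continuous_of_finiteDimensional g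
    refine this.comp ?_
    fun_prop
  let v : (Fin n → ℝ) → ℕ → Fin m → ℝ := fun x t j =>
    if h : t < n then w x (⟨n - 1 - t, by omega⟩, j) else 0
  have hvc : ∀ t, Continuous fun x => v x t := by
    intro t
    refine continuous_pi fun j => ?_
    by_cases h : t < n
    · simp only [v, h, dif_pos]
      fun_prop
    · simp only [v, h, dif_neg, not_false_eq_true]
      fun_prop
  let c : (Fin m → ℝ) → ℝ := fun u => u ⬝ᵥ R.mulVec u
  have hcc : Continuous c := by
    simp only [c]
    fun_prop
  let f : (Fin n → ℝ) → ℝ := fun x => ∑ t ∈ Finset.range n, (c (ue + v x t) - c ue)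
  have hfc : Continuous f := by
    refine continuous_finsetSum _ fun t _ => ?_
    have := hvc t
    fun_prop
  have hcnn : ∀ u, 0 ≤ c u := fun u => by
    have := hR.posSemidef.dotProduct_mulVec_nonneg u
    simpa using this
  obtain ⟨M, hM⟩ := hK.exists_bound_of_continuousOn hfc.continuousOn
  refine ⟨|M| + 1, by positivity, fun x hx T hT => ?_⟩
  have hv0 : ∀ t, n ≤ t → v x t = 0 := by
    intro t ht
    ext j
    simp [v, Nat.not_lt.mpr ht]
  have hn : traj A B q x (fun t => ue + v x t) n = xe := by
    rw [traj_err A B q x xe ue heq]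
    have : ∑ k ∈ Finset.range n, (A ^ k * B) *ᵥ (v x (n - 1 - k)) = -((A ^ n) *ᵥ (x - xe)) := by
      rw [← hw, ctrb_mulVec, Finset.sum_range]
      refine Finset.sum_congr rfl fun k _ => ?_
      congr 1
      ext j
      have h1 : n - 1 - (k : ℕ) < n := by omega
      have h2 : n - 1 - (n - 1 - (k : ℕ)) = k := by omega
      simp only [v, h1, dif_pos]
      congr 2
      exact Fin.ext h2
    rw [this]
    simp
  have hadm : Admissible A B q τ T₀ T x (fun t => ue + v x t) := by
    intro t ht _ i
    rw [traj_stay A B q x xe ue heq _ n hn (fun t ht => by simp [hv0 t ht]) t (hT₀.trans ht)]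
    exact hxe i
  refine le_trans (csInf_le (a := ∑ t ∈ Finset.range T, c (ue + v x t)) ⟨0, ?_⟩
    ⟨_, hadm, rfl⟩) ?_
  · rintro _ ⟨u, _, rfl⟩
    exact Finset.sum_nonneg fun t _ => hcnn _
  · have hs : ∑ t ∈ Finset.range T, (c (ue + v x t) - c ue) = f x := by
      refine (Finset.sum_subset (Finset.range_mono (hT₀.trans hT)) fun t _ ht => ?_).symm
      simp [hv0 t (by simpa using ht)]
    rw [Finset.sum_sub_distrib] at hs
    simp only [Finset.sum_const, Finset.card_range, nsmul_eq_mul] at hs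
    have h1 := hM x hx
    rw [Real.norm_eq_abs] at h1
    have h2 := le_abs_self (f x)
    have h3 := le_abs_self M
    change ∑ t ∈ Finset.range T, c (ue + v x t) ≤ T * c ue + _
    linarith
end

section
/- Consider the system x(t+1) = A x(t) + B u(t) + (I − A) q with stage cost c(u) = uᵀ R u, R symmetric positive definite, threshold τ ∈ ℝⁿ, and an equilibrium (xᵉ, uᵉ) with xᵉ = A xᵉ + B uᵉ + (I − A) q and xᵉ ≥ τ componentwise. Assume: (i) there exist g : ℝⁿ → ℝ bounded below and ρ : [0,∞) → [0,∞) strictly increasing continuous with ρ(0) = 0 such that c(u) − c(uᵉ) + g(x) − g(A x + B u + (I − A) q) ≥ ρ(‖x − xᵉ‖) for all x ∈ ℝⁿ, u ∈ ℝᵐ (strict dissipativity); (ii) the controllability matrix [B, AB, …, A^{n−1}B] has rank n; and (iii) T₀ ≥ n. Then the constrained optimal control problem (minimize ∑_{t=0}^{T−1} c(u(t)) subject to x(t) ≥ τ componentwise for t ∈ {T₀,…,T}) has the turnpike property at (xᵉ, uᵉ): for every compact K ⊂ ℝⁿ and every ε > 0 there exists C_{K,ε} > 0 such that for all x̄ ∈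 K, all horizons T ≥ T₀, and every admissible control achieving the optimal cost J*_T(x̄), the number of time instants t ∈ {T₀,…,T} at which the resulting state satisfies ‖x(t) − xᵉ‖ > ε is at most C_{K,ε}. -/
open Matrix

/-- The trajectory of the affine system `x(t+1) = A x(t) + B u(t) + (I - A) q` starting
from `x(0) = x̄` under the control sequence `u`. -/
noncomputable def trajE {n m : ℕ} (A : Matrix (Fin n) (Fin n) ℝ)
    (B : Matrix (Fin n) (Fin m) ℝ) (q xbar : EuclideanSpace ℝ (Fin n))
    (u : ℕ → EuclideanSpace ℝ (Fin m)) : ℕ → EuclideanSpace ℝ (Fin n)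
  | 0 => xbar
  | t + 1 => mulVecE A (trajE A B q xbar u t) + mulVecE B (u t) + mulVecE (1 - A) q

/-- The stage cost `c(u) = uᵀ R u`. -/
noncomputable def stageCost {m : ℕ} (R : Matrix (Fin m) (Fin m) ℝ)
    (u : EuclideanSpace ℝ (Fin m)) : ℝ :=
  ∑ i, ∑ j, u i * R i j * u j

/-- A control sequence is admissible for horizon `T` (with campaign start `T₀`) from `x̄`
if its trajectory satisfies the state constraint `x(t) ≥ τ` for all `t ∈ {T₀, …, T}`. -/
def AdmissibleE {n m : ℕ} (A : Matrix (Fin n) (Fin n) ℝ) (B : Matrix (Fin n) (Fin m) ℝ)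
    (q τ : EuclideanSpace ℝ (Fin n)) (T₀ T : ℕ) (xbar : EuclideanSpace ℝ (Fin n))
    (u : ℕ → EuclideanSpace ℝ (Fin m)) : Prop :=
  ∀ t, T₀ ≤ t → t ≤ T → ∀ i, τ i ≤ trajE A B q xbar u t i

/-- The optimal constrained cost `J*_T(x̄)`. -/
noncomputable def Jstar {n m : ℕ} (A : Matrix (Fin n) (Fin n) ℝ)
    (B : Matrix (Fin n) (Fin m) ℝ) (q τ : EuclideanSpace ℝ (Fin n))
    (R : Matrix (Fin m) (Fin m) ℝ) (T₀ T : ℕ) (xbar : EuclideanSpace ℝ (Fin n)) : ℝ :=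
  sInf {c : ℝ | ∃ u : ℕ → EuclideanSpace ℝ (Fin m), AdmissibleE A B q τ T₀ T xbar u ∧
    (∑ t ∈ Finset.range T, stageCost R (u t)) = c}

lemma mulVecE_ofLp {n m : ℕ} (M : Matrix (Fin n) (Fin m) ℝ) (x : EuclideanSpace ℝ (Fin m)) :
    (mulVecE M x).ofLp = M *ᵥ x.ofLp := by
  ext i; simp [mulVecE, Matrix.mulVec, dotProduct]

lemma traj_formula {n m : ℕ}
    (A : Matrix (Fin n) (Fin n) ℝ) (B : Matrix (Fin n) (Fin m) ℝ)
    (q xe : EuclideanSpace ℝ (Fin n)) (ue : EuclideanSpace ℝ (Fin m))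
    (heq : xe = mulVecE A xe + mulVecE B ue + mulVecE (1 - A) q)
    (a : EuclideanSpace ℝ (Fin n)) (u : ℕ → EuclideanSpace ℝ (Fin m)) (t : ℕ) :
    (trajE A B q a u t).ofLp = xe.ofLp + A ^ t *ᵥ (a.ofLp - xe.ofLp)
      + ∑ k ∈ Finset.range t, (A ^ k * B) *ᵥ ((u (t - 1 - k)).ofLp - ue.ofLp) := by
  induction t with
  | zero => simp [trajE]
  | succ t ih =>
    have h2 : xe.ofLp = A *ᵥ xe.ofLp + B *ᵥ ue.ofLp + (1 - A) *ᵥ q.ofLp := by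
      have := congrArg WithLp.ofLp heq
      simpa [mulVecE_ofLp] using this
    have h1 : (trajE A B q a u (t+1)).ofLp = A *ᵥ (trajE A B q a u t).ofLp
        + B *ᵥ (u t).ofLp + (1 - A) *ᵥ q.ofLp := by
      simp [trajE, mulVecE_ofLp]
    have h3 : ∑ k ∈ Finset.range (t+1), (A ^ k * B) *ᵥ ((u (t + 1 - 1 - k)).ofLp - ue.ofLp)
        = A *ᵥ (∑ k ∈ Finset.range t, (A ^ k * B) *ᵥ ((u (t - 1 - k)).ofLp - ue.ofLp))
          + B *ᵥ ((u t).ofLp - ue.ofLp) := by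
      rw [Finset.sum_range_succ', Matrix.mulVec_sum]
      congr 1
      · refine Finset.sum_congr rfl fun k _ => ?_
        rw [Matrix.mulVec_mulVec, pow_succ', Matrix.mul_assoc]
        have e : t + 1 - 1 - (k + 1) = t - 1 - k := by omega
        rw [e]
      · simp
    rw [h1, h3, ih, Matrix.mulVec_add, Matrix.mulVec_add, Matrix.mulVec_mulVec, ← pow_succ',
      Matrix.mulVec_sub B]
    conv_rhs => rw [h2]
    have h4 : A ^ (t+1) *ᵥ (a.ofLp - (A *ᵥ xe.ofLp + B *ᵥ ue.ofLp + (1 - A) *ᵥ q.ofLp))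
       = A ^ (t+1) *ᵥ (a.ofLp - xe.ofLp) := by rw [← h2]
    rw [h4]
    abel

lemma steer {n m : ℕ}
    (A : Matrix (Fin n) (Fin n) ℝ) (B : Matrix (Fin n) (Fin m) ℝ)
    (q xe : EuclideanSpace ℝ (Fin n)) (ue : EuclideanSpace ℝ (Fin m))
    (heq : xe = mulVecE A xe + mulVecE B ue + mulVecE (1 - A) q)
    (hrank : (ctrbMatrix A B).rank = n) :
    ∃ U : EuclideanSpace ℝ (Fin n) → EuclideanSpace ℝ (Fin n) → ℕ → EuclideanSpace ℝ (Fin m),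
      (∀ t, Continuous fun p : EuclideanSpace ℝ (Fin n) × EuclideanSpace ℝ (Fin n) =>
        U p.1 p.2 t) ∧
      (∀ a b, trajE A B q a (U a b) n = b) ∧ ∀ a b t, n ≤ t → U a b t = ue := by
  have hsurj : LinearMap.range (ctrbMatrix A B).mulVecLin = ⊤ := by
    apply Submodule.eq_top_of_finrank_eq
    rw [← Matrix.rank, hrank]; simp
  obtain ⟨S, hS⟩ := LinearMap.exists_rightInverse_of_surjective _ hsurj
  have hS' : ∀ d, (ctrbMatrix A B) *ᵥ (S d) = d := fun d => by
    have := congrArg (fun f => f d) hS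
    simpa using this
  have hSc : Continuous S := S.continuous_of_finiteDimensional
  refine ⟨fun a b t => if h : t < n then ue + WithLp.toLp 2 fun j =>
      S (b.ofLp - xe.ofLp - A ^ n *ᵥ (a.ofLp - xe.ofLp)) (⟨n - 1 - t, by omega⟩, j) else ue,
    ?_, ?_, ?_⟩
  · intro t
    by_cases h : t < n
    · simp only [h, dite_true]
      refine continuous_const.add ((PiLp.continuous_toLp 2 _).comp ?_)
      refine continuous_pi fun j => ?_
      refine (continuous_apply _).comp (hSc.comp ?_)
      have hA : Continuous fun v : Fin n → ℝ => A ^ n *ᵥ v :=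
        Continuous.matrix_mulVec continuous_const continuous_id
      have h1 : Continuous fun v : EuclideanSpace ℝ (Fin n) => v.ofLp := PiLp.continuous_ofLp 2 _
      exact ((h1.comp continuous_snd).sub continuous_const).sub
        (hA.comp ((h1.comp continuous_fst).sub continuous_const))
    · simp only [h, dite_false]; exact continuous_const
  · intro a b
    apply WithLp.ofLp_injective
    rw [traj_formula A B q xe ue heq]
    set w := S (b.ofLp - xe.ofLp - A ^ n *ᵥ (a.ofLp - xe.ofLp)) with hw
    have hd := hS' (b.ofLp - xe.ofLp - A ^ n *ᵥ (a.ofLp - xe.ofLp))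
    rw [← hw] at hd
    have : ∑ k ∈ Finset.range n, (A ^ k * B) *ᵥ
        ((if h : n - 1 - k < n then ue + WithLp.toLp 2 fun j =>
          w (⟨n - 1 - (n - 1 - k), by omega⟩, j) else ue : EuclideanSpace ℝ (Fin m)).ofLp - ue.ofLp)
        = ctrbMatrix A B *ᵥ w := by
      rw [Finset.sum_range]
      ext i
      simp only [Finset.sum_apply, Matrix.mulVec, dotProduct, ctrbMatrix, Matrix.of_apply,
        Fintype.sum_prod_type]
      refine Finset.sum_congr rfl fun k _ => Finset.sum_congr rfl fun j _ => ?_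
      have hk := k.2
      have h1 : n - 1 - (k:ℕ) < n := by omega
      have h2 : n - 1 - (n - 1 - (k:ℕ)) = k := by omega
      simp [h1, h2]
    rw [this, hd]
    abel
  · intro a b t h
    simp [Nat.not_lt.mpr h]

lemma stageCost_cont {m : ℕ} (R : Matrix (Fin m) (Fin m) ℝ) : Continuous (stageCost R) := by
  unfold stageCost
  fun_prop

lemma stageCost_nonneg {m : ℕ} (R : Matrix (Fin m) (Fin m) ℝ) (hR : R.PosDef)
    (u : EuclideanSpace ℝ (Fin m)) : 0 ≤ stageCost R u := by
  have h := hR.posSemidef.dotProduct_mulVec_nonneg u.ofLp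
  have : stageCost R u = star u.ofLp ⬝ᵥ (R *ᵥ u.ofLp) := by
    simp [stageCost, dotProduct, Matrix.mulVec, Finset.mul_sum, mul_assoc]
  rw [this]; exact h

/-- **main turnpike theorem.** Under strict dissipativity (with storage
function `g` bounded below and dissipation rate `ρ` strictly increasing, continuous,
vanishing at `0`), the rank-`n` controllability condition, and `T₀ ≥ n`, the constrained
optimal control problem has the turnpike property at the equilibrium `(xᵉ, uᵉ)`: for
every compact `K` and `ε > 0` there is `C > 0` bounding, uniformly over `x̄ ∈ K`,
horizons `T ≥ T₀`, and optimal admissible controls, the number of times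
`t ∈ {T₀, …, T}` at which the optimal trajectory is farther than `ε` from `xᵉ`. -/
theorem turnpike_property {n m : ℕ}
    (A : Matrix (Fin n) (Fin n) ℝ) (B : Matrix (Fin n) (Fin m) ℝ)
    (q τ : EuclideanSpace ℝ (Fin n))
    (R : Matrix (Fin m) (Fin m) ℝ) (hR : R.PosDef)
    (xe : EuclideanSpace ℝ (Fin n)) (ue : EuclideanSpace ℝ (Fin m))
    (heq : xe = mulVecE A xe + mulVecE B ue + mulVecE (1 - A) q)
    (hxe : ∀ i, τ i ≤ xe i)
    (g : EuclideanSpace ℝ (Fin n) → ℝ) (gmin : ℝ) (hgmin : ∀ x, gmin ≤ g x)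
    (ρ : ℝ → ℝ) (hρ0 : ρ 0 = 0) (hρmono : StrictMonoOn ρ (Set.Ici 0))
    (hρcont : ContinuousOn ρ (Set.Ici 0)) (hρnonneg : ∀ s, 0 ≤ s → 0 ≤ ρ s)
    (hdiss : ∀ (x : EuclideanSpace ℝ (Fin n)) (u : EuclideanSpace ℝ (Fin m)),
      ρ ‖x - xe‖ ≤ stageCost R u - stageCost R ue + g x -
        g (mulVecE A x + mulVecE B u + mulVecE (1 - A) q))
    (hrank : (ctrbMatrix A B).rank = n)
    (T₀ : ℕ) (hT₀ : n ≤ T₀) :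
    ∀ K : Set (EuclideanSpace ℝ (Fin n)), IsCompact K → ∀ ε > (0 : ℝ),
      ∃ C > (0 : ℝ), ∀ xbar ∈ K, ∀ T : ℕ, T₀ ≤ T →
        ∀ u : ℕ → EuclideanSpace ℝ (Fin m),
        AdmissibleE A B q τ T₀ T xbar u →
        (∑ t ∈ Finset.range T, stageCost R (u t)) = Jstar A B q τ R T₀ T xbar →
        (((Finset.Icc T₀ T).filter fun t => ε < ‖trajE A B q xbar u t - xe‖).card : ℝ) ≤ C := by
  intro K hK ε hε
  obtain ⟨U, hUc, hUn, hUe⟩ := steer A B q xe ue heq hrank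
  have hsum : ∀ (x : EuclideanSpace ℝ (Fin n)) (u : ℕ → EuclideanSpace ℝ (Fin m)) (T : ℕ),
      ∑ t ∈ Finset.range T, ρ ‖trajE A B q x u t - xe‖ ≤
        ∑ t ∈ Finset.range T, (stageCost R (u t) - stageCost R ue) + g x
          - g (trajE A B q x u T) := by
    intro x u T
    induction T with
    | zero => simp [trajE]
    | succ T ih =>
      rw [Finset.sum_range_succ, Finset.sum_range_succ]
      have := hdiss (trajE A B q x u T) (u T)
      simp only [trajE]
      linarith
  have hcont : ∀ P : EuclideanSpace ℝ (Fin n) → EuclideanSpace ℝ (Fin n) × EuclideanSpace ℝ (Fin n),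
      Continuous P → ∃ M, ∀ x ∈ K,
        ‖∑ t ∈ Finset.range n, (stageCost R (U (P x).1 (P x).2 t) - stageCost R ue)‖ ≤ M := by
    intro P hP
    refine hK.exists_bound_of_continuousOn (Continuous.continuousOn ?_)
    refine continuous_finsetSum _ fun t _ => ?_
    exact ((stageCost_cont R).comp ((hUc t).comp hP)).sub continuous_const
  obtain ⟨M1, hM1⟩ := hcont (fun x => (x, xe)) (by fun_prop)
  obtain ⟨M2, hM2⟩ := hcont (fun x => (xe, x)) (by fun_prop)
  have hg : ∀ x ∈ K, g x ≤ g xe + M2 := by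
    intro x hx
    have h1 := hsum xe (U xe x) n
    rw [hUn] at h1
    have h2 := (le_abs_self _).trans (hM2 x hx)
    have h3 : 0 ≤ ∑ t ∈ Finset.range n, ρ ‖trajE A B q xe (U xe x) t - xe‖ :=
      Finset.sum_nonneg fun t _ => hρnonneg _ (norm_nonneg _)
    simp only at h2
    linarith
  have hρε : 0 < ρ ε := by
    rw [← hρ0]; exact hρmono (by simp) (by simpa using hε.le) hε
  refine ⟨|(M1 + g xe + M2 - gmin) / ρ ε| + 1, by positivity, ?_⟩
  intro x hx T hT u _ hopt
  have hstay : ∀ t, n ≤ t → trajE A B q x (U x xe) t = xe := by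
    intro t ht
    induction t, ht using Nat.le_induction with
    | base => exact hUn _ _
    | succ t ht ih => simp only [trajE, ih, hUe _ _ t ht]; exact heq.symm
  have hJ : Jstar A B q τ R T₀ T x ≤ ∑ t ∈ Finset.range T, stageCost R (U x xe t) := by
    refine csInf_le ⟨0, ?_⟩ ⟨U x xe, ?_, rfl⟩
    · rintro c ⟨v, _, rfl⟩
      exact Finset.sum_nonneg fun t _ => stageCost_nonneg R hR _
    · intro t ht _ i
      rw [hstay t (hT₀.trans ht)]; exact hxe i
  have hcost : ∑ t ∈ Finset.range T, (stageCost R (U x xe t) - stageCost R ue) ≤ M1 := by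
    have h2 := (le_abs_self _).trans (hM1 x hx)
    refine le_trans (le_of_eq ?_) h2
    symm
    refine Finset.sum_subset (Finset.range_mono (hT₀.trans hT)) fun t _ ht => ?_
    rw [hUe _ _ t (by simpa using ht), sub_self]
  have hmain := hsum x u T
  rw [Finset.sum_sub_distrib, hopt] at hmain
  rw [Finset.sum_sub_distrib] at hcost
  have hle : ∑ t ∈ Finset.range T, ρ ‖trajE A B q x u t - xe‖ ≤ M1 + g xe + M2 - gmin := by
    have := hg x hx
    have := hgmin (trajE A B q x u T)
    linarith
  set F := (Finset.range T).filter fun t => ε < ‖trajE A B q x u t - xe‖ with hF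
  have hFc : (F.card : ℝ) * ρ ε ≤ M1 + g xe + M2 - gmin := by
    refine le_trans ?_ hle
    rw [← nsmul_eq_mul]
    refine (Finset.card_nsmul_le_sum F (fun t => ρ ‖trajE A B q x u t - xe‖) _ ?_).trans ?_
    · intro t ht
      have := (Finset.mem_filter.mp ht).2
      exact (hρmono (by simpa using hε.le) (by simp) this).le
    · exact Finset.sum_le_sum_of_subset_of_nonneg (Finset.filter_subset _ _)
        fun t _ _ => hρnonneg _ (norm_nonneg _)
  have hsub : ((Finset.Icc T₀ T).filter fun t => ε < ‖trajE A B q x u t - xe‖) ⊆ insert T F := by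
    intro t ht
    simp only [Finset.mem_filter, Finset.mem_Icc, Finset.mem_insert, hF, Finset.mem_range] at ht ⊢
    rcases eq_or_lt_of_le ht.1.2 with h | h
    · exact Or.inl h
    · exact Or.inr ⟨h, ht.2⟩
  have hcard := (Finset.card_le_card hsub).trans (Finset.card_insert_le _ _)
  have hcard' : (((Finset.Icc T₀ T).filter fun t => ε < ‖trajE A B q x u t - xe‖).card : ℝ)
      ≤ (F.card : ℝ) + 1 := by exact_mod_cast hcard
  have h5 : (F.card : ℝ) ≤ (M1 + g xe + M2 - gmin) / ρ ε := by
    rw [le_div_iff₀ hρε]; exact hFc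
  have := le_abs_self ((M1 + g xe + M2 - gmin) / ρ ε)
  linarith
end
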